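/- arXiv:2307.00034 — 7 statements merged into one kernel-verified Lean document; each statement's English description precedes it below -/
import Mathlib

section
/- Let u₁, u₂, u₃, u₄ be unit vectors in the Euclidean space ℝ³ satisfying the balancing condition u₁ + u₂ + u₃ + u₄ = 0. Then the angle-bisector vectors δ₁₀₂ = u₁ + u₂ and δ₁₀₃ = u₁ + u₃ are orthogonal: ⟪u₁ + u₂, u₁ + u₃⟫ = 0. -/
open RealInnerProductSpace

theorem fermat_torricelli_bisectors_orthogonal_102_103
    (u₁ u₂ u₃ u₄ : EuclideanSpace ℝ (Fin 3))
    (h₁ : ‖u₁‖ = 1) (h₂ : ‖u₂‖ = 1) (h₃ : ‖u₃‖ = 1) (h₄ : ‖u₄‖ = 1)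
    (hbal : u₁ + u₂ + u₃ + u₄ = 0) :
    ⟪u₁ + u₂, u₁ + u₃⟫ = 0 := by
  have e : u₄ = -(u₁ + u₂ + u₃) := (neg_eq_of_add_eq_zero_right hbal).symm
  have k : ⟪u₁ + u₂ + u₃, u₁ + u₂ + u₃⟫ = 1 := by
    rw [real_inner_self_eq_norm_sq, ← norm_neg, ← e, h₄]; norm_num
  have k₁ : ⟪u₁, u₁⟫ = 1 := by rw [real_inner_self_eq_norm_sq, h₁]; norm_num
  have k₂ : ⟪u₂, u₂⟫ = 1 := by rw [real_inner_self_eq_norm_sq, h₂]; norm_num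
  have k₃ : ⟪u₃, u₃⟫ = 1 := by rw [real_inner_self_eq_norm_sq, h₃]; norm_num
  simp only [inner_add_left, inner_add_right] at k ⊢
  have c₁ := real_inner_comm u₁ u₂
  have c₂ := real_inner_comm u₁ u₃
  have c₃ := real_inner_comm u₂ u₃
  linarith
end

section
/- Fundamental property of the Fermat–Torricelli point for tetrahedra: Let u₁, u₂, u₃, u₄ be unit vectors in the Euclidean space ℝ³ satisfying the balancing condition u₁ + u₂ + u₃ + u₄ = 0. Then (i) the three bisector vectors δ₁₀₂ = u₁ + u₂, δ₁₀₃ = u₁ + u₃, δ₂₀₃ = u₂ + u₃ are pairwise orthogonal, and (ii) the bisector vectors of opposite angle pairs are negatives of one another: u₃ + u₄ = -(u₁ + u₂), u₁ + u₄ = -(u₂ + u₃), and u₂ + u₄ = -(u₁ + u₃). Hence the three bisecting lines of the pairs of equal angles seen by opposite edges of the tetrahedron meet perpendicularly at the Fermat–Torricelli point. -/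
open RealInnerProductSpace

theorem fermat_torricelli_fundamental_property
    (u₁ u₂ u₃ u₄ : EuclideanSpace ℝ (Fin 3))
    (h₁ : ‖u₁‖ = 1) (h₂ : ‖u₂‖ = 1) (h₃ : ‖u₃‖ = 1) (h₄ : ‖u₄‖ = 1)
    (hbal : u₁ + u₂ + u₃ + u₄ = 0) :
    (⟪u₁ + u₂, u₁ + u₃⟫ = 0 ∧ ⟪u₁ + u₂, u₂ + u₃⟫ = 0 ∧ ⟪u₁ + u₃, u₂ + u₃⟫ = 0) ∧
    (u₃ + u₄ = -(u₁ + u₂) ∧ u₁ + u₄ = -(u₂ + u₃) ∧ u₂ + u₄ = -(u₁ + u₃)) := by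
  have e : u₄ = -(u₁ + u₂ + u₃) := by
    rw [eq_neg_iff_add_eq_zero, add_comm]; exact hbal
  have i₁ : ⟪u₁, u₁⟫ = 1 := by rw [real_inner_self_eq_norm_sq, h₁]; norm_num
  have i₂ : ⟪u₂, u₂⟫ = 1 := by rw [real_inner_self_eq_norm_sq, h₂]; norm_num
  have i₃ : ⟪u₃, u₃⟫ = 1 := by rw [real_inner_self_eq_norm_sq, h₃]; norm_num
  have i₄ : ⟪u₄, u₄⟫ = 1 := by rw [real_inner_self_eq_norm_sq, h₄]; norm_num
  rw [e, inner_neg_neg] at i₄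
  have c₁ := real_inner_comm u₁ u₂
  have c₂ := real_inner_comm u₁ u₃
  have c₃ := real_inner_comm u₂ u₃
  simp only [inner_add_left, inner_add_right] at i₄ ⊢
  refine ⟨⟨by linarith, by linarith, by linarith⟩, ?_, ?_, ?_⟩ <;> rw [e] <;> abel
end

section
/- Let u₁, u₂, u₃, u₄ be unit vectors in the Euclidean space ℝ³, write c_{ij} = ⟪u_i, u_j⟫ (so c_{ij} = cos α_{i0j}), and assume c₁₂² ≠ 1. Set b = sqrt(∏_{i=3,4} (2(c₁₂² + c₁ᵢ² + c₂ᵢ²) - 2 - 4 c₁₂ c₁ᵢ c₂ᵢ)). Then there exists ε ∈ {-1, 1} such that c₃₄ = (1/(4(1 - c₁₂²))) · [4 c₁₃ (c₁₄ - c₁₂ c₂₄) + 2(ε·b + 2 c₂₃ (-c₁₂ c₁₄ + c₂₄))]. In other words, the cosine of the sixth angle α₃₀₄ among four rays emanating from a common point in ℝ³ is determined, up to the sign of b, by the five angles α₁₀₂, α₁₀₃, α₁₀₄, α₂₀₃, α₂₀₄. -/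
open RealInnerProductSpace

def sixthDet (x y z : EuclideanSpace ℝ (Fin 3)) : ℝ :=
  x 0 * (y 1 * z 2 - y 2 * z 1) - x 1 * (y 0 * z 2 - y 2 * z 0) + x 2 * (y 0 * z 1 - y 1 * z 0)

lemma sixthDet_mul (x y z w : EuclideanSpace ℝ (Fin 3)) (hx : ‖x‖ = 1) (hy : ‖y‖ = 1) :
    sixthDet x y z * sixthDet x y w = ⟪z, w⟫ - ⟪x, y⟫ ^ 2 * ⟪z, w⟫ - ⟪x, z⟫ * ⟪x, w⟫
      - ⟪y, z⟫ * ⟪y, w⟫ + ⟪x, y⟫ * (⟪x, z⟫ * ⟪y, w⟫ + ⟪x, w⟫ * ⟪y, z⟫) := by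
  have h1 : ⟪x, x⟫ = (1 : ℝ) := by rw [real_inner_self_eq_norm_sq, hx]; norm_num
  have h2 : ⟪y, y⟫ = (1 : ℝ) := by rw [real_inner_self_eq_norm_sq, hy]; norm_num
  have key : sixthDet x y z * sixthDet x y w = ⟪x, x⟫ * ⟪y, y⟫ * ⟪z, w⟫ - ⟪x, y⟫ ^ 2 * ⟪z, w⟫
      - ⟪y, y⟫ * ⟪x, z⟫ * ⟪x, w⟫ - ⟪x, x⟫ * ⟪y, z⟫ * ⟪y, w⟫
      + ⟪x, y⟫ * (⟪x, z⟫ * ⟪y, w⟫ + ⟪x, w⟫ * ⟪y, z⟫) := by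
    simp only [sixthDet, PiLp.inner_apply, Fin.sum_univ_three, RCLike.inner_apply, conj_trivial]
    ring
  rw [key, h1, h2]; ring

theorem sixth_angle_determined_by_five
    (u₁ u₂ u₃ u₄ : EuclideanSpace ℝ (Fin 3))
    (h₁ : ‖u₁‖ = 1) (h₂ : ‖u₂‖ = 1) (h₃ : ‖u₃‖ = 1) (h₄ : ‖u₄‖ = 1)
    (c₁₂ c₁₃ c₁₄ c₂₃ c₂₄ c₃₄ b : ℝ)
    (hc₁₂ : c₁₂ = ⟪u₁, u₂⟫) (hc₁₃ : c₁₃ = ⟪u₁, u₃⟫) (hc₁₄ : c₁₄ = ⟪u₁, u₄⟫)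
    (hc₂₃ : c₂₃ = ⟪u₂, u₃⟫) (hc₂₄ : c₂₄ = ⟪u₂, u₄⟫) (hc₃₄ : c₃₄ = ⟪u₃, u₄⟫)
    (hc : c₁₂ ^ 2 ≠ 1)
    (hb : b = Real.sqrt ((2 * (c₁₂ ^ 2 + c₁₃ ^ 2 + c₂₃ ^ 2) - 2 - 4 * c₁₂ * c₁₃ * c₂₃) *
      (2 * (c₁₂ ^ 2 + c₁₄ ^ 2 + c₂₄ ^ 2) - 2 - 4 * c₁₂ * c₁₄ * c₂₄))) :
    ∃ ε : ℝ, (ε = -1 ∨ ε = 1) ∧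
      c₃₄ = (1 / (4 * (1 - c₁₂ ^ 2))) *
        (4 * c₁₃ * (c₁₄ - c₁₂ * c₂₄) + 2 * (ε * b + 2 * c₂₃ * (-(c₁₂ * c₁₄) + c₂₄))) := by
  have e34 := sixthDet_mul u₁ u₂ u₃ u₄ h₁ h₂
  have e33 := sixthDet_mul u₁ u₂ u₃ u₃ h₁ h₂
  have e44 := sixthDet_mul u₁ u₂ u₄ u₄ h₁ h₂
  have h33 : ⟪u₃, u₃⟫ = (1 : ℝ) := by rw [real_inner_self_eq_norm_sq, h₃]; norm_num
  have h44 : ⟪u₄, u₄⟫ = (1 : ℝ) := by rw [real_inner_self_eq_norm_sq, h₄]; norm_num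
  rw [h33] at e33
  rw [h44] at e44
  rw [← hc₁₂, ← hc₁₃, ← hc₁₄, ← hc₂₃, ← hc₂₄, ← hc₃₄] at e34
  rw [← hc₁₂, ← hc₁₃, ← hc₂₃] at e33
  rw [← hc₁₂, ← hc₁₄, ← hc₂₄] at e44
  generalize sixthDet u₁ u₂ u₃ = p at *
  generalize sixthDet u₁ u₂ u₄ = q at *
  have hb' : b = |2 * (p * q)| := by
    rw [hb, ← Real.sqrt_sq_eq_abs]
    congr 1
    have : (2 * (p * q)) ^ 2 = (-2 * (p * p)) * (-2 * (q * q)) := by ring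
    rw [this, e33, e44]
    ring
  have hne : 1 - c₁₂ ^ 2 ≠ 0 := fun h => hc (by linarith)
  have fin : ∀ t : ℝ, t = 2 * (p * q) → c₃₄ = (1 / (4 * (1 - c₁₂ ^ 2))) *
        (4 * c₁₃ * (c₁₄ - c₁₂ * c₂₄) + 2 * (t + 2 * c₂₃ * (-(c₁₂ * c₁₄) + c₂₄))) := by
    intro t ht
    rw [one_div, eq_inv_mul_iff_mul_eq₀ (by simpa using hne), ht, e34]
    ring
  rcases abs_choice (2 * (p * q)) with h | h
  · exact ⟨1, Or.inr rfl, fin _ (by rw [hb', h]; ring)⟩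
  · exact ⟨-1, Or.inl rfl, fin _ (by rw [hb', h]; ring)⟩
end

section
/- Existence and uniqueness of the Fermat–Torricelli point of a tetrahedron: Let A₁, A₂, A₃, A₄ be four affinely independent points (non-collinear and non-coplanar) in the Euclidean space ℝ³. Then there exists a unique point A₀ ∈ ℝ³ minimizing the function f(x) = ∑_{i=1}^{4} dist(x, A_i). -/
theorem fermat_torricelli_exists_unique
    (A : Fin 4 → EuclideanSpace ℝ (Fin 3)) (hA : AffineIndependent ℝ A) :
    ∃! A₀ : EuclideanSpace ℝ (Fin 3),
      ∀ x : EuclideanSpace ℝ (Fin 3), ∑ i, dist A₀ (A i) ≤ ∑ i, dist x (A i) := by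
  have hcont : Continuous fun x : EuclideanSpace ℝ (Fin 3) => ∑ i, dist x (A i) := by fun_prop
  have hlim : Filter.Tendsto (fun x : EuclideanSpace ℝ (Fin 3) => ∑ i, dist x (A i))
      (Filter.cocompact _) Filter.atTop := by
    refine Filter.tendsto_atTop_mono (fun x => ?_) (tendsto_dist_right_cocompact_atTop (A 0))
    exact Finset.single_le_sum (f := fun i => dist x (A i)) (fun i _ => dist_nonneg)
      (Finset.mem_univ 0)
  obtain ⟨p, hp⟩ := hcont.exists_forall_le hlim
  refine ⟨p, hp, fun q hq => ?_⟩
  by_contra hne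
  set m := (1 / 2 : ℝ) • (p + q) with hm
  have hm2 : ∀ i, 2 * dist m (A i) = ‖(p - A i) + (q - A i)‖ := by
    intro i
    have : (p - A i) + (q - A i) = (2 : ℝ) • (m - A i) := by
      rw [hm]; module
    rw [this, norm_smul, dist_eq_norm]; norm_num
  have hle : ∀ i ∈ Finset.univ, 2 * dist m (A i) ≤ dist p (A i) + dist q (A i) := by
    intro i _
    rw [hm2, dist_eq_norm, dist_eq_norm]
    exact norm_add_le _ _
  have hsum : ∑ i, 2 * dist m (A i) = ∑ i, (dist p (A i) + dist q (A i)) := by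
    apply le_antisymm (Finset.sum_le_sum hle)
    rw [← Finset.mul_sum, Finset.sum_add_distrib]
    have h1 := hp m
    have h2 := hq m
    linarith
  have heq := (Finset.sum_eq_sum_iff_of_le hle).1 hsum
  have hcol : Collinear ℝ (Set.range A) := by
    rw [collinear_iff_exists_forall_eq_smul_vadd]
    refine ⟨p, p - q, ?_⟩
    rintro _ ⟨i, rfl⟩
    have h := heq i (Finset.mem_univ i)
    rw [hm2, dist_eq_norm, dist_eq_norm, ← sameRay_iff_norm_add] at h
    obtain ⟨a, b, -, -, -, hu, hv⟩ := h.exists_eq_smul_add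
    set w := (p - A i) + (q - A i)
    have hpq : p - q = (a - b) • w := by
      rw [sub_smul, ← hu, ← hv]; abel
    have hab : a - b ≠ 0 := by
      intro h0
      rw [h0, zero_smul, sub_eq_zero] at hpq
      exact hne hpq.symm
    refine ⟨-(a / (a - b)), ?_⟩
    rw [hpq, smul_smul, neg_mul, div_mul_cancel₀ _ hab, neg_smul, ← hu, vadd_eq_add]
    abel
  have h3 := hA.finrank_vectorSpan (n := 3) (by simp)
  have h1 := collinear_iff_finrank_le_one.1 hcol
  omega
end

section
/- Sufficiency of the balancing condition: Let A₁, A₂, A₃, A₄ be four points in the Euclidean space ℝ³ and let A₀ ∈ ℝ³ with A₀ ∉ {A₁, A₂, A₃, A₄}. If the unit vectors from A₀ to the four points balance, i.e. ∑_{i=1}^{4} (A_i - A₀)/‖A_i - A₀‖ = 0, then A₀ is a global minimizer of f(x) = ∑_{i=1}^{4} dist(x, A_i), i.e. f(A₀) ≤ f(x) for all x ∈ ℝ³. -/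
theorem fermat_torricelli_balancing_sufficient
    (A : Fin 4 → EuclideanSpace ℝ (Fin 3)) (A₀ : EuclideanSpace ℝ (Fin 3))
    (hne : ∀ i, A₀ ≠ A i)
    (hbal : ∑ i, (‖A i - A₀‖)⁻¹ • (A i - A₀) = 0) :
    ∀ x : EuclideanSpace ℝ (Fin 3), ∑ i, dist A₀ (A i) ≤ ∑ i, dist x (A i) := by
  intro x
  have key : ∀ i, dist A₀ (A i) ≤
      dist x (A i) + inner ℝ ((‖A i - A₀‖)⁻¹ • (A i - A₀)) (x - A₀) := by
    intro i
    have hpos : 0 < ‖A i - A₀‖ := norm_pos_iff.mpr (sub_ne_zero.mpr (hne i).symm)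
    have h1 : inner ℝ (A i - A₀) (A i - x) ≤ ‖A i - A₀‖ * ‖A i - x‖ :=
      real_inner_le_norm _ _
    have h2 : inner ℝ (A i - A₀) (A i - x)
        = ‖A i - A₀‖ ^ 2 - inner ℝ (A i - A₀) (x - A₀) := by
      rw [← real_inner_self_eq_norm_sq, ← inner_sub_right]
      congr 1
      abel
    rw [dist_comm, dist_eq_norm, dist_comm, dist_eq_norm, real_inner_smul_left]
    have h3 : ‖A i - A₀‖ * (‖A i - A₀‖⁻¹ * inner ℝ (A i - A₀) (x - A₀))
        = inner ℝ (A i - A₀) (x - A₀) := by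
      field_simp
    refine le_of_mul_le_mul_left ?_ hpos
    rw [mul_add, h3]
    nlinarith
  have hs := Finset.sum_le_sum (fun i (_ : i ∈ Finset.univ) => key i)
  rw [Finset.sum_add_distrib, ← sum_inner, hbal, inner_zero_left, add_zero] at hs
  exact hs
end

section
/- Fermat–Cavallieri (vertex) solution: Let A₁, A₂, A₃, A₄ be four pairwise distinct points in the Euclidean space ℝ³ and let i ∈ {1,2,3,4}. If ‖∑_{j ≠ i} (A_i - A_j)/‖A_i - A_j‖‖ ≤ 1, then the vertex A_i is a global minimizer of f(x) = ∑_{k=1}^{4} dist(x, A_k), i.e. f(A_i) ≤ f(x) for all x ∈ ℝ³. -/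
theorem fermat_cavallieri_vertex_solution
    (A : Fin 4 → EuclideanSpace ℝ (Fin 3)) (hA : Function.Injective A) (i : Fin 4)
    (h : ‖∑ j ∈ Finset.univ.erase i, (‖A i - A j‖)⁻¹ • (A i - A j)‖ ≤ 1) :
    ∀ x : EuclideanSpace ℝ (Fin 3), ∑ k, dist (A i) (A k) ≤ ∑ k, dist x (A k) := by
  intro x
  have key : ∀ j ∈ Finset.univ.erase i,
      dist (A i) (A j) + inner ℝ ((‖A i - A j‖)⁻¹ • (A i - A j)) (x - A i) ≤ dist x (A j) := by
    intro j hj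
    have hne : A i - A j ≠ 0 :=
      sub_ne_zero.2 (fun e => (Finset.ne_of_mem_erase hj) (hA e).symm)
    have hpos : 0 < ‖A i - A j‖ := norm_pos_iff.2 hne
    have h1 := real_inner_le_norm ((‖A i - A j‖)⁻¹ • (A i - A j)) (x - A j)
    have hu : ‖(‖A i - A j‖)⁻¹ • (A i - A j)‖ = 1 := by
      rw [norm_smul, norm_inv, norm_norm, inv_mul_cancel₀ hpos.ne']
    have h2 : inner ℝ ((‖A i - A j‖)⁻¹ • (A i - A j)) (A i - A j) = ‖A i - A j‖ := by
      rw [real_inner_smul_left, real_inner_self_eq_norm_sq]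
      field_simp
    have h3 : x - A j = (A i - A j) + (x - A i) := by abel
    rw [hu, one_mul] at h1
    rw [dist_eq_norm, dist_eq_norm]
    calc _ = inner ℝ ((‖A i - A j‖)⁻¹ • (A i - A j)) (x - A j) := by
          rw [h3, inner_add_right, h2]
      _ ≤ _ := h1
  have hs := Finset.sum_le_sum key
  rw [Finset.sum_add_distrib, ← sum_inner] at hs
  have h4 := neg_le_of_abs_le (abs_real_inner_le_norm
    (∑ j ∈ Finset.univ.erase i, (‖A i - A j‖)⁻¹ • (A i - A j)) (x - A i))
  have h5 := mul_le_mul_of_nonneg_right h (norm_nonneg (x - A i))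
  rw [← Finset.add_sum_erase _ _ (Finset.mem_univ i),
    ← Finset.add_sum_erase _ (fun k => dist x (A k)) (Finset.mem_univ i), dist_self,
    dist_eq_norm x (A i)]
  linarith
end

section
/- Floating case criterion: Let A₁, A₂, A₃, A₄ be four affinely independent points in the Euclidean space ℝ³ and suppose that for every i ∈ {1,2,3,4}, ‖∑_{j ≠ i} (A_i - A_j)/‖A_i - A_j‖‖ > 1. Then any point A₀ minimizing f(x) = ∑_{k=1}^{4} dist(x, A_k) satisfies A₀ ∉ {A₁, A₂, A₃, A₄}, and consequently ∑_{i=1}^{4} (A_i - A₀)/‖A_i - A₀‖ = 0 (the Fermat–Torricelli solution). -/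
lemma ft_right_deriv_nonneg (h : ℝ → ℝ) (d : ℝ) (hd : HasDerivAt h d 0)
    (hm : ∀ t, 0 ≤ t → h 0 ≤ h t) : 0 ≤ d := by
  have h1 := hd.tendsto_slope_zero_right
  refine ge_of_tendsto h1 ?_
  filter_upwards [self_mem_nhdsWithin] with t ht
  have ht' : (0 : ℝ) < t := ht
  have := hm t ht'.le
  rw [zero_add, smul_eq_mul]
  exact mul_nonneg (inv_nonneg.2 ht'.le) (by linarith)

lemma ft_dist_deriv {E : Type*} [NormedAddCommGroup E] [InnerProductSpace ℝ E]
    (x a w : E) (hx : x ≠ a) :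
    HasDerivAt (fun t : ℝ => dist (x - t • w) a)
      (-(inner ℝ ((‖x - a‖)⁻¹ • (x - a)) w)) 0 := by
  have h0 : HasDerivAt (fun t : ℝ => x - t • w - a) (-w) 0 := by
    have := (((hasDerivAt_id (0 : ℝ)).smul_const w).const_sub x).sub_const a
    simpa using this
  have h1 := h0.norm_sq
  have hpos : 0 < ‖x - a‖ := norm_pos_iff.2 (sub_ne_zero.2 hx)
  have h2 := h1.sqrt (by simpa using sub_ne_zero.2 hx)
  have h3 : (fun t : ℝ => dist (x - t • w) a) = fun t : ℝ => √(‖x - t • w - a‖ ^ 2) := by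
    funext t
    rw [Real.sqrt_sq (norm_nonneg _), dist_eq_norm]
  rw [h3]
  convert h2 using 1
  rw [Real.sqrt_sq (norm_nonneg _)]
  simp only [zero_smul, sub_zero, inner_neg_right, real_inner_smul_left]
  field_simp

lemma ft_sum_deriv {E : Type*} [NormedAddCommGroup E] [InnerProductSpace ℝ E] {ι : Type*}
    (S : Finset ι) (A : ι → E) (x w : E) (hx : ∀ k ∈ S, x ≠ A k) :
    HasDerivAt (fun t : ℝ => ∑ k ∈ S, dist (x - t • w) (A k))
      (-(inner ℝ (∑ k ∈ S, (‖x - A k‖)⁻¹ • (x - A k)) w)) 0 := by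
  rw [sum_inner, ← Finset.sum_neg_distrib]
  exact HasDerivAt.fun_sum fun k hk => ft_dist_deriv x (A k) w (hx k hk)

theorem fermat_torricelli_floating_case
    (A : Fin 4 → EuclideanSpace ℝ (Fin 3)) (hA : AffineIndependent ℝ A)
    (hcrit : ∀ i : Fin 4,
      1 < ‖∑ j ∈ Finset.univ.erase i, (‖A i - A j‖)⁻¹ • (A i - A j)‖)
    (A₀ : EuclideanSpace ℝ (Fin 3))
    (hmin : ∀ x : EuclideanSpace ℝ (Fin 3), ∑ k, dist A₀ (A k) ≤ ∑ k, dist x (A k)) :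
    (∀ i, A₀ ≠ A i) ∧ ∑ i, (‖A i - A₀‖)⁻¹ • (A i - A₀) = 0 := by
  have hne : ∀ i, A₀ ≠ A i := by
    rintro i rfl
    have hc := hcrit i
    set w := ∑ j ∈ Finset.univ.erase i, (‖A i - A j‖)⁻¹ • (A i - A j) with hw
    have hd := ft_sum_deriv (Finset.univ.erase i) A (A i) w (fun k hk h =>
      (Finset.ne_of_mem_erase hk) (hA.injective h).symm)
    rw [← hw, real_inner_self_eq_norm_sq] at hd
    have hd2 := hd.add ((hasDerivAt_id (0 : ℝ)).mul_const ‖w‖)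
    have := ft_right_deriv_nonneg _ _ hd2 (fun t ht => by
      have h1 := hmin (A i - t • w)
      rw [← Finset.sum_erase_add _ _ (Finset.mem_univ i),
        ← Finset.sum_erase_add _ _ (Finset.mem_univ i)] at h1
      have h2 : dist (A i - t • w) (A i) = t * ‖w‖ := by
        rw [dist_eq_norm, sub_sub_cancel_left, norm_neg, norm_smul, Real.norm_of_nonneg ht]
      rw [h2] at h1
      simpa using h1)
    nlinarith
  refine ⟨hne, ?_⟩
  set w := ∑ k, (‖A₀ - A k‖)⁻¹ • (A₀ - A k) with hw
  have hd := ft_sum_deriv Finset.univ A A₀ w (fun k _ => hne k)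
  rw [← hw, real_inner_self_eq_norm_sq] at hd
  have := ft_right_deriv_nonneg _ _ hd (fun t _ => by simpa using hmin (A₀ - t • w))
  have hw0 : w = 0 := by
    have : ‖w‖ ^ 2 = 0 := le_antisymm (by linarith) (sq_nonneg _)
    simpa using this
  have : ∑ i, (‖A i - A₀‖)⁻¹ • (A i - A₀) = -w := by
    rw [hw, ← Finset.sum_neg_distrib]
    refine Finset.sum_congr rfl fun i _ => ?_
    rw [norm_sub_rev, ← smul_neg, neg_sub]
  rw [this, hw0, neg_zero]
end
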